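/- Let θ > 1 be a real number. Then the function G(x) = ∫₀^∞ log(1 + a^{−θ}) / (a + e^{−x}) da is holomorphic (complex differentiable) on the open strip {x ∈ ℂ : |Im x| < π}. Consequently Vθ(x) = exp(G(x)/(2πi)) is holomorphic on this strip. -/

import Mathlib

open MeasureTheory

/-- The Stieltjes transform of a function integrable on `(0, ∞)` is holomorphic on the slit
plane. -/
theorem differentiableOn_stieltjes_slitPlane {f : ℝ → ℂ} (hf : IntegrableOn f (Set.Ioi 0)) :
    DifferentiableOn ℂ (fun w : ℂ => ∫ a in Set.Ioi (0 : ℝ), f a / ((a : ℂ) + w))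
      Complex.slitPlane := by
  intro w₀ hw₀
  obtain ⟨ε, hε, hball⟩ := Metric.isOpen_iff.1 Complex.isOpen_slitPlane w₀ hw₀
  set δ := ε / 2 with hδ
  have hδ0 : 0 < δ := half_pos hε
  have hdist : ∀ w ∈ Metric.ball w₀ δ, ∀ a ∈ Set.Ioi (0 : ℝ), δ ≤ ‖(a : ℂ) + w‖ := by
    intro w hw a ha
    by_contra! hlt
    have hmem : -(a : ℂ) ∈ Metric.ball w₀ ε := by
      have h₁ : dist (-(a : ℂ)) w < δ := by
        rw [dist_eq_norm, ← norm_neg]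
        simpa [add_comm] using hlt
      have h₂ := dist_triangle (-(a : ℂ)) w w₀
      rw [Metric.mem_ball] at hw ⊢
      linarith
    have hslit := hball hmem
    rw [← Complex.ofReal_neg, Complex.ofReal_mem_slitPlane] at hslit
    linarith [Set.mem_Ioi.1 ha]
  have hmeas (w : ℂ) (n : ℕ) : AEStronglyMeasurable (fun a : ℝ => (((a : ℂ) + w) ^ n)⁻¹)
      (volume.restrict (Set.Ioi 0)) := by
    have : Measurable fun a : ℝ => (((a : ℂ) + w) ^ n)⁻¹ := by fun_prop
    exact this.aestronglyMeasurable
  have hF_meas (w : ℂ) : AEStronglyMeasurable (fun a : ℝ => f a / ((a : ℂ) + w))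
      (volume.restrict (Set.Ioi 0)) := by
    simpa [div_eq_mul_inv] using hf.aestronglyMeasurable.fun_mul (hmeas w 1)
  refine (hasDerivAt_integral_of_dominated_loc_of_deriv_le
    (F' := fun w a => -f a / ((a : ℂ) + w) ^ 2) (bound := fun a => ‖f a‖ / δ ^ 2)
    (Metric.ball_mem_nhds w₀ hδ0) (.of_forall hF_meas) ?_ ?_ ?_ ?_
    ?_).2.differentiableAt.differentiableWithinAt
  · refine (hf.norm.div_const δ).mono' (hF_meas w₀) ?_
    refine (ae_restrict_iff' measurableSet_Ioi).2 (.of_forall fun a ha => ?_)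
    rw [norm_div]
    gcongr
    exact hdist w₀ (Metric.mem_ball_self hδ0) a ha
  · simpa [div_eq_mul_inv] using hf.aestronglyMeasurable.fun_neg.fun_mul (hmeas w₀ 2)
  · refine (ae_restrict_iff' measurableSet_Ioi).2 (.of_forall fun a ha w hw => ?_)
    rw [norm_div, norm_neg, norm_pow]
    gcongr
    exact hdist w hw a ha
  · exact hf.norm.div_const _
  · refine (ae_restrict_iff' measurableSet_Ioi).2 (.of_forall fun a ha w hw => ?_)
    have hne : (a : ℂ) + w ≠ 0 := norm_pos_iff.1 (hδ0.trans_le (hdist w hw a ha))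
    simpa using (hasDerivAt_const w (f a)).fun_div ((hasDerivAt_id w).const_add (a : ℂ)) hne

/-- For `1 < θ`, the function `log (1 + a ^ (-θ))` is integrable on `(0, ∞)`. -/
theorem integrableOn_log_one_add_rpow_neg {θ : ℝ} (hθ : 1 < θ) :
    IntegrableOn (fun a : ℝ => Real.log (1 + a ^ (-θ))) (Set.Ioi 0) := by
  have hmeas : Measurable fun a : ℝ => Real.log (1 + a ^ (-θ)) := by fun_prop
  have hnorm {a : ℝ} (ha : 0 < a) :
      ‖Real.log (1 + a ^ (-θ))‖ = Real.log (1 + a ^ (-θ)) :=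
    Real.norm_of_nonneg (Real.log_nonneg (by linarith [Real.rpow_pos_of_pos ha (-θ)]))
  rw [← Set.Ioc_union_Ioi_eq_Ioi (zero_le_one' ℝ)]
  refine IntegrableOn.union ?_ ?_
  · have hlog : IntegrableOn (fun a : ℝ => Real.log 2 - θ * Real.log a) (Set.Ioc 0 1) := by
      refine (intervalIntegrable_iff_integrableOn_Ioc_of_le zero_le_one).1 ?_
      exact intervalIntegrable_const.sub (intervalIntegral.intervalIntegrable_log'.const_mul θ)
    refine hlog.mono' hmeas.aestronglyMeasurable ?_
    refine (ae_restrict_iff' measurableSet_Ioc).2 (.of_forall fun a ha => ?_)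
    have hpos := Real.rpow_pos_of_pos ha.1 (-θ)
    have hone : 1 ≤ a ^ (-θ) :=
      Real.one_le_rpow_of_pos_of_le_one_of_nonpos ha.1 ha.2 (by linarith)
    calc ‖Real.log (1 + a ^ (-θ))‖ = Real.log (1 + a ^ (-θ)) := hnorm ha.1
      _ ≤ Real.log (2 * a ^ (-θ)) := Real.log_le_log (by positivity) (by linarith)
      _ = Real.log 2 - θ * Real.log a := by
        rw [Real.log_mul two_ne_zero hpos.ne', Real.log_rpow ha.1]
        ring
  · refine (integrableOn_Ioi_rpow_of_lt (neg_lt_neg hθ) one_pos).mono'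
      hmeas.aestronglyMeasurable ?_
    refine (ae_restrict_iff' measurableSet_Ioi).2 (.of_forall fun a ha => ?_)
    have ha0 : 0 < a := one_pos.trans ha
    rw [hnorm ha0]
    have := Real.log_le_sub_one_of_pos (add_pos one_pos (Real.rpow_pos_of_pos ha0 (-θ)))
    linarith

/-- The exponential maps the strip `|Im z| < π` into the slit plane. -/
theorem exp_mem_slitPlane_of_abs_im_lt_pi {z : ℂ} (hz : |z.im| < Real.pi) :
    Complex.exp z ∈ Complex.slitPlane := by
  obtain ⟨h₁, h₂⟩ := abs_lt.1 hz
  refine Complex.mem_slitPlane_iff_arg.2 ⟨?_, Complex.exp_ne_zero z⟩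
  rw [← Complex.log_im, Complex.log_exp h₁ h₂.le]
  exact h₂.ne

/-- For `θ > 1`, the function
`G(x) = ∫₀^∞ log(1 + a^{−θ}) / (a + e^{−x}) da` is holomorphic on the open strip
`{x ∈ ℂ : |Im x| < π}`, and consequently `Vθ(x) = exp(G(x)/(2πi))` is holomorphic there. -/
theorem stmt3 (θ : ℝ) (hθ : 1 < θ) :
    DifferentiableOn ℂ
      (fun x : ℂ =>
        ∫ a in Set.Ioi (0 : ℝ), (Real.log (1 + a ^ (-θ)) : ℂ) / ((a : ℂ) + Complex.exp (-x)))
      {x : ℂ | |x.im| < Real.pi} ∧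
    DifferentiableOn ℂ
      (fun x : ℂ =>
        Complex.exp
          ((∫ a in Set.Ioi (0 : ℝ),
              (Real.log (1 + a ^ (-θ)) : ℂ) / ((a : ℂ) + Complex.exp (-x))) /
            (2 * (Real.pi : ℂ) * Complex.I)))
      {x : ℂ | |x.im| < Real.pi} := by
  have hG : DifferentiableOn ℂ
      (fun x : ℂ =>
        ∫ a in Set.Ioi (0 : ℝ), (Real.log (1 + a ^ (-θ)) : ℂ) / ((a : ℂ) + Complex.exp (-x)))
      {x : ℂ | |x.im| < Real.pi} :=
    (differentiableOn_stieltjes_slitPlane (integrableOn_log_one_add_rpow_neg hθ).ofReal).comp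
      (by fun_prop) fun x hx => exp_mem_slitPlane_of_abs_im_lt_pi (by simpa using hx)
  exact ⟨hG, (hG.div_const _).cexp⟩
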